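/- arXiv:1302.1298 — 2 statements merged into one kernel-verified Lean document; each statement's English description precedes it below -/
import Mathlib

section
/- (Relations in the BC-case for k = 3) Let 0 = i_0 < i_1 < i_2 < i_3 be integers and work in R = ℂ[x_1,x_2,x_3]. Let S_3, S_2, S_1 be the Schur polynomials attached as usual to the exponent triples (0,i_1,i_2), (0,i_1,i_3), (0,i_2,i_3) respectively, let G_0 = s_{(i_3−i_1−2,\ i_2−i_1−1,\ 0)} be the Schur polynomial of the exponent triple (0, i_2−i_1, i_3−i_1), and for s = 0,1,2 let s_{(i_1−1, i_1−1, 2−s)} denote the Schur polynomial of the partition (i_1−1, i_1−1, 2−s), with the convention that this symbol is 0 when 2−s > i_1−1. Then for each s ∈ {0,1,2}: h_{i_3−i_1−s}·S_3 − h_{i_2−i_1−s}·S_2 + h_{−s}·S_1 − s_{(i_1−1, i_1−1, 2−s)}·G_0 = 0, where h_d is the complete homogeneous symmetric polynomial of degree d in x_1,x_2,x_3 (h_d = 0 for d < 0, h_0 = 1). -/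
open MvPolynomial

/-- The complete homogeneous symmetric polynomial of degree `d ∈ ℤ` in `x₁, x₂, x₃`,
with the convention `h_d = 0` for `d < 0` (and `h_0 = 1`). -/
noncomputable def completeHomog3 (d : ℤ) : MvPolynomial (Fin 3) ℂ :=
  if 0 ≤ d then
    ∑ μ ∈ Finset.Nat.antidiagonalTuple 3 d.toNat, ∏ b : Fin 3, (X b : MvPolynomial (Fin 3) ℂ) ^ μ b
  else 0

/-- The Vandermonde determinant `∏_{1 ≤ b < b' ≤ 3} (x_b - x_{b'})` in `ℂ[x₁,x₂,x₃]`. -/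
noncomputable def vdm3 : MvPolynomial (Fin 3) ℂ :=
  ∏ b : Fin 3, ∏ b' ∈ Finset.Ioi b, ((X b : MvPolynomial (Fin 3) ℂ) - X b')

/-- `IsSchur3 e P` says that `P` is the Schur polynomial whose alternant has the
(weakly decreasing) exponent vector `e`; for a partition `λ = (λ₁ ≥ λ₂ ≥ λ₃)` the Schur
polynomial `s_λ` is characterized by `s_λ · ∏_{b<b'}(x_b - x_{b'}) = det (x_b^{λ_a+3-a})`,
i.e. `s_λ = IsSchur3 ![λ₁+2, λ₂+1, λ₃]`, and the Schur polynomial of an increasing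
exponent triple `j₁ < j₂ < j₃` is `s_{(j₃-2, j₂-1, j₁)}`, i.e. `IsSchur3 ![j₃, j₂, j₁]`. -/
def IsSchur3 (e : Fin 3 → ℕ) (P : MvPolynomial (Fin 3) ℂ) : Prop :=
  P * vdm3 = Matrix.det (Matrix.of fun a b : Fin 3 => (X b : MvPolynomial (Fin 3) ℂ) ^ e a)

/-- `(x - y) * ∑_{i + j = n} x ^ i * y ^ j = x ^ (n + 1) - y ^ (n + 1)`. -/
theorem sum_antidiagonal_pow_mul_pow_mul_sub {R : Type*} [CommRing R] (x y : R) (n : ℕ) :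
    (∑ p ∈ Finset.HasAntidiagonal.antidiagonal n, x ^ p.1 * y ^ p.2) * (x - y) = x ^ (n + 1) - y ^ (n + 1) := by
  rw [Finset.Nat.sum_antidiagonal_eq_sum_range_succ (fun i j => x ^ i * y ^ j), ← geom_sum₂_mul]
  simp

/-- The bialternant formula for complete homogeneous polynomials in three variables. -/
theorem sum_antidiagonalTuple_three_mul_vandermonde {R : Type*} [CommRing R] (x : Fin 3 → R)
    (n : ℕ) :
    (∑ μ ∈ Finset.Nat.antidiagonalTuple 3 n, ∏ b, x b ^ μ b) *
        ((x 0 - x 1) * (x 0 - x 2) * (x 1 - x 2)) =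
      x 1 * (x 0 ^ (n + 1) - x 1 ^ (n + 1)) * (x 0 - x 2) -
        x 2 * (x 0 ^ (n + 1) - x 2 ^ (n + 1)) * (x 0 - x 1) := by
  have hsum : ∑ μ ∈ Finset.Nat.antidiagonalTuple 3 n, ∏ b, x b ^ μ b =
      ∑ p ∈ Finset.HasAntidiagonal.antidiagonal n,
        x 0 ^ p.1 * ∑ q ∈ Finset.HasAntidiagonal.antidiagonal p.2, x 1 ^ q.1 * x 2 ^ q.2 := by
    simp_rw [Finset.mul_sum]
    rw [Finset.sum_sigma']
    refine Finset.sum_nbij' (fun μ => ⟨(μ 0, μ 1 + μ 2), (μ 1, μ 2)⟩)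
      (fun a => ![a.1.1, a.2.1, a.2.2]) ?_ ?_ ?_ ?_ ?_
    · intro μ hμ
      simpa [Finset.Nat.mem_antidiagonalTuple, Fin.sum_univ_three, add_assoc] using hμ
    · rintro ⟨⟨a, b⟩, c, d⟩ h
      simp only [Finset.mem_sigma, Finset.HasAntidiagonal.mem_antidiagonal] at h
      simp [Finset.Nat.mem_antidiagonalTuple, Fin.sum_univ_three]
      omega
    · intro μ _
      ext i
      fin_cases i <;> rfl
    · rintro ⟨⟨a, b⟩, c, d⟩ h
      simp only [Finset.mem_sigma, Finset.HasAntidiagonal.mem_antidiagonal] at h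
      obtain ⟨-, rfl⟩ := h
      rfl
    · intro μ _
      simp [Fin.prod_univ_three, mul_assoc]
  have hdiff : (∑ μ ∈ Finset.Nat.antidiagonalTuple 3 n, ∏ b, x b ^ μ b) * (x 1 - x 2) =
      x 1 * ∑ p ∈ Finset.HasAntidiagonal.antidiagonal n, x 0 ^ p.1 * x 1 ^ p.2 -
        x 2 * ∑ p ∈ Finset.HasAntidiagonal.antidiagonal n, x 0 ^ p.1 * x 2 ^ p.2 := by
    rw [hsum, Finset.sum_mul, Finset.mul_sum, Finset.mul_sum, ← Finset.sum_sub_distrib]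
    refine Finset.sum_congr rfl fun p _ => ?_
    rw [mul_assoc, sum_antidiagonal_pow_mul_pow_mul_sub]
    ring
  rw [← sum_antidiagonal_pow_mul_pow_mul_sub (x 0) (x 1),
    ← sum_antidiagonal_pow_mul_pow_mul_sub (x 0) (x 2)]
  linear_combination (x 0 - x 1) * (x 0 - x 2) * hdiff

theorem vdm3_eq : vdm3 =
    ((X 0 : MvPolynomial (Fin 3) ℂ) - X 1) * (X 0 - X 2) * (X 1 - X 2) := by
  have e0 : Finset.Ioi (0 : Fin 3) = {1, 2} := by decide
  have e1 : Finset.Ioi (1 : Fin 3) = {2} := by decide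
  have e2 : Finset.Ioi (2 : Fin 3) = ∅ := by decide
  simp [vdm3, Fin.prod_univ_three, e0, e1, e2]

theorem vdm3_ne_zero : vdm3 ≠ 0 := by
  have h : ∀ i j : Fin 3, i ≠ j → (X i : MvPolynomial (Fin 3) ℂ) - X j ≠ 0 :=
    fun i j hij => sub_ne_zero.mpr fun e => hij (X_injective e)
  rw [vdm3_eq]
  exact mul_ne_zero (mul_ne_zero (h 0 1 (by decide)) (h 0 2 (by decide))) (h 1 2 (by decide))

/-- The complete homogeneous polynomial of degree `m - 2` is the Schur polynomial of the exponent
vector `(m, 1, 0)`; for `m < 2` both vanish. -/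
theorem isSchur3_completeHomog3 (m : ℕ) (d : ℤ) (hd : d = (m : ℤ) - 2) :
    IsSchur3 ![m, 1, 0] (completeHomog3 d) := by
  subst hd
  unfold IsSchur3
  match m with
  | 0 => simp [completeHomog3, Matrix.det_fin_three]; ring
  | 1 => simp [completeHomog3, Matrix.det_fin_three]; ring
  | n + 2 =>
    have hn : ((n + 2 : ℕ) : ℤ) - 2 = n := by push_cast; ring
    rw [hn, completeHomog3, if_pos (Int.natCast_nonneg n), Int.toNat_natCast, vdm3_eq,
      sum_antidiagonalTuple_three_mul_vandermonde, Matrix.det_fin_three]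
    simp
    ring

/-- **Relations in the `BC`-case for `k = 3`** (Conjecture `Brel`, proved in the paper for
`k = 3`). Let `0 = i₀ < i₁ < i₂ < i₃`, let `S₃, S₂, S₁` be the Schur polynomials of the
exponent triples `(0,i₁,i₂)`, `(0,i₁,i₃)`, `(0,i₂,i₃)`, let `G₀` be the Schur polynomial
of `(0, i₂-i₁, i₃-i₁)`, and for `s = 0,1,2` let `T s` be the Schur polynomial of the
partition `(i₁-1, i₁-1, 2-s)`, with the convention that it is `0` when `2-s > i₁-1`.
Then for each `s ∈ {0,1,2}`:
`h_{i₃-i₁-s}·S₃ - h_{i₂-i₁-s}·S₂ + h_{-s}·S₁ - s_{(i₁-1,i₁-1,2-s)}·G₀ = 0`. -/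
theorem bc_schur_relations_k3 (i1 i2 i3 : ℕ) (h1 : 0 < i1) (h2 : i1 < i2) (h3 : i2 < i3)
    (S3 S2 S1 G0 : MvPolynomial (Fin 3) ℂ)
    (hS3 : IsSchur3 ![i2, i1, 0] S3) (hS2 : IsSchur3 ![i3, i1, 0] S2)
    (hS1 : IsSchur3 ![i3, i2, 0] S1) (hG0 : IsSchur3 ![i3 - i1, i2 - i1, 0] G0)
    (T : ℕ → MvPolynomial (Fin 3) ℂ)
    (hT : ∀ s, s ≤ 2 →
      (if i1 - 1 < 2 - s then T s = 0 else IsSchur3 ![i1 + 1, i1, 2 - s] (T s))) :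
    ∀ s : ℕ, s ≤ 2 →
      completeHomog3 ((i3 : ℤ) - (i1 : ℤ) - (s : ℤ)) * S3
        - completeHomog3 ((i2 : ℤ) - (i1 : ℤ) - (s : ℤ)) * S2
        + completeHomog3 (-(s : ℤ)) * S1 - T s * G0 = 0 := by
  intro s hs
  have hT' : IsSchur3 ![i1 + 1, i1, 2 - s] (T s) := by
    have h := hT s hs
    split_ifs at h with hlt
    · have hcol : 2 - s = i1 ∨ 2 - s = i1 + 1 := by omega
      rw [h, IsSchur3, Matrix.det_fin_three]
      rcases hcol with e | e <;> simp [e] <;> ring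
    · exact h
  obtain ⟨q, rfl⟩ := Nat.exists_eq_add_of_lt h2
  obtain ⟨r, rfl⟩ := Nat.exists_eq_add_of_lt h3
  have hA := isSchur3_completeHomog3 (q + r + 2 + (2 - s))
    (((i1 + q + 1 + r + 1 : ℕ) : ℤ) - (i1 : ℤ) - (s : ℤ)) (by omega)
  have hB := isSchur3_completeHomog3 (q + 1 + (2 - s))
    (((i1 + q + 1 : ℕ) : ℤ) - (i1 : ℤ) - (s : ℤ)) (by omega)
  have hC := isSchur3_completeHomog3 (2 - s) (-(s : ℤ)) (by omega)
  have e1 : i1 + q + 1 + r + 1 - i1 = q + r + 2 := by omega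
  have e2 : i1 + q + 1 - i1 = q + 1 := by omega
  rw [e1, e2] at hG0
  generalize 2 - s = t at *
  unfold IsSchur3 at hS3 hS2 hS1 hG0 hT' hA hB hC
  refine (mul_eq_zero.mp ?_).resolve_right (mul_ne_zero vdm3_ne_zero vdm3_ne_zero)
  set A := completeHomog3 (((i1 + q + 1 + r + 1 : ℕ) : ℤ) - (i1 : ℤ) - (s : ℤ))
  set B := completeHomog3 (((i1 + q + 1 : ℕ) : ℤ) - (i1 : ℤ) - (s : ℤ))
  set C := completeHomog3 (-(s : ℤ))
  calc (A * S3 - B * S2 + C * S1 - T s * G0) * (vdm3 * vdm3)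
      = (A * vdm3) * (S3 * vdm3) - (B * vdm3) * (S2 * vdm3) + (C * vdm3) * (S1 * vdm3)
          - (T s * vdm3) * (G0 * vdm3) := by ring
    _ = 0 := by
      rw [hA, hB, hC, hS3, hS2, hS1, hG0, hT']
      simp only [Matrix.det_fin_three, Matrix.of_apply, Matrix.cons_val]
      ring
end

section
/- Let k ≥ 2 and let I ⊆ ℕ be a finite set of integers. Let V_{k;I} = { (α_1,…,α_k) ∈ ℂ^k : α_k ≠ 0 and there exists u : ℕ → ℂ not identically zero with u(n) + α_1·u(n−1) + ⋯ + α_k·u(n−k) = 0 for all n ≥ k and u(i) = 0 for all i ∈ I }. Then V_{k;I} is a constructible subset of ℂ^k with respect to the Zariski topology, i.e. a finite union of sets of the form U ∩ Z with U Zariski open and Z Zariski closed; consequently the closure of V_{k;I} in the Euclidean topology of ℂ^k coincides with its Zariski closure and is an affine algebraic set (the common zero locus of a family of polynomials). -/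
/-- A subset of `ℂ^k` is Zariski closed iff it is the common zero locus of a family of
polynomials in `ℂ[x₁,…,x_k]`. -/
def IsZariskiClosed (k : ℕ) (Z : Set (Fin k → ℂ)) : Prop :=
  ∃ T : Set (MvPolynomial (Fin k) ℂ), Z = {x | ∀ p ∈ T, MvPolynomial.eval x p = 0}

/-- The linear recurrence variety `V_{k;I} ⊆ L_k^* ⊆ ℂ^k`: the set of coefficient
tuples `(α₁,…,α_k)` with `α_k ≠ 0` such that the linear recurrence
`u n + α₁ u (n-1) + ⋯ + α_k u (n-k) = 0` (`n ≥ k`) has a non-trivial solution vanishing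
at every point of `I`. -/
def recVariety (k : ℕ) (hk : 1 ≤ k) (I : Finset ℕ) : Set (Fin k → ℂ) :=
  {α | α ⟨k - 1, by omega⟩ ≠ 0 ∧
    ∃ u : ℕ → ℂ, u ≠ 0 ∧ (∀ n, k ≤ n → u n + ∑ j : Fin k, α j * u (n - ((j : ℕ) + 1)) = 0) ∧
      ∀ n ∈ I, u n = 0}

open Filter Topology

/-- A ring homomorphism into an algebraically closed field extends along an injective integral
ring extension. -/
theorem exists_ringHom_extend_of_isIntegral {R S K : Type*} [CommRing R] [CommRing S] [Field K]
    [IsAlgClosed K] [Algebra R S] [Algebra.IsIntegral R S] [FaithfulSMul R S] (ψ : R →+* K) :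
    ∃ φ : S →+* K, φ.comp (algebraMap R S) = ψ := by
  have hker : (RingHom.ker ψ).IsPrime := RingHom.ker_isPrime ψ
  obtain ⟨Q, -, hQ, hQ'⟩ := Ideal.exists_ideal_over_prime_of_isIntegral (S := S) (RingHom.ker ψ) ⊥
    (by
      intro x hx
      have : algebraMap R S x = algebraMap R S 0 := by simpa using hx
      rw [FaithfulSMul.algebraMap_injective R S this]
      exact zero_mem _)
  have : Q.LiesOver (RingHom.ker ψ) := ⟨hQ'.symm⟩
  algebraize [RingHom.kerLift ψ]
  have : FaithfulSMul (R ⧸ RingHom.ker ψ) K :=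
    (faithfulSMul_iff_algebraMap_injective _ _).2 (RingHom.kerLift_injective ψ)
  have : Module.IsTorsionFree (R ⧸ RingHom.ker ψ) (S ⧸ Q) :=
    Module.isTorsionFree_iff_faithfulSMul.2 inferInstance
  have : Module.IsTorsionFree (R ⧸ RingHom.ker ψ) K :=
    Module.isTorsionFree_iff_faithfulSMul.2 inferInstance
  refine ⟨((IsAlgClosed.lift : (S ⧸ Q) →ₐ[R ⧸ RingHom.ker ψ] K) : (S ⧸ Q) →+* K).comp
    (Ideal.Quotient.mk Q), ?_⟩
  ext r
  exact (IsAlgClosed.lift : (S ⧸ Q) →ₐ[R ⧸ RingHom.ker ψ] K).commutes (Ideal.Quotient.mk _ r)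

/-- In an integral extension of an integrally closed domain, every root of the specialised
minimal polynomial of an element is the value of that element at a point of the fibre. -/
theorem exists_ringHom_extend_apply_eq {R S K : Type*} [CommRing R] [IsDomain R]
    [IsIntegrallyClosed R] [CommRing S] [IsDomain S] [Field K] [IsAlgClosed K] [Algebra R S]
    [Algebra.IsIntegral R S] [FaithfulSMul R S] (ψ : R →+* K) (s : S) (z : K)
    (hz : (minpoly R s).eval₂ ψ z = 0) :
    ∃ φ : S →+* K, φ.comp (algebraMap R S) = ψ ∧ φ s = z := by
  have hs : IsIntegral R s := Algebra.IsIntegral.isIntegral s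
  let e := minpoly.equivAdjoin hs
  let ψ' : Algebra.adjoin R {s} →+* K :=
    (AdjoinRoot.lift ψ z hz).comp (e.symm : Algebra.adjoin R {s} →+* AdjoinRoot (minpoly R s))
  have : Algebra.IsIntegral (Algebra.adjoin R {s}) S := Algebra.IsIntegral.tower_top R
  obtain ⟨φ, hφ⟩ := exists_ringHom_extend_of_isIntegral (S := S) ψ'
  refine ⟨φ, ?_, ?_⟩
  · ext r
    have := RingHom.congr_fun hφ (algebraMap R _ r)
    have h2 : e.symm (algebraMap R _ r) = algebraMap R _ r := e.symm.commutes r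
    simp only [RingHom.comp_apply, ψ'] at this ⊢
    rw [IsScalarTower.algebraMap_apply R (Algebra.adjoin R {s}) S, this]
    simp only [RingHom.coe_coe]
    rw [h2, AdjoinRoot.algebraMap_eq, AdjoinRoot.lift_of]
  · have := RingHom.congr_fun hφ ⟨s, Algebra.self_mem_adjoin_singleton R s⟩
    have h2 : e.symm ⟨s, Algebra.self_mem_adjoin_singleton R s⟩ = AdjoinRoot.root _ := by
      rw [AlgEquiv.symm_apply_eq]
      simp [e]
    simp only [RingHom.comp_apply, ψ', RingHom.coe_coe, h2, AdjoinRoot.lift_root] at this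
    exact this

/-- A monic complex polynomial of positive degree that is small at `z` has a root near `z`. -/
theorem Polynomial.Monic.exists_isRoot_norm_sub_pow_le {p : Polynomial ℂ} (hp : p.Monic)
    (hd : p.natDegree ≠ 0) (z : ℂ) :
    ∃ w, p.IsRoot w ∧ ‖z - w‖ ^ p.natDegree ≤ ‖p.eval z‖ := by
  have hsplit := IsAlgClosed.splits p
  have hcard : p.roots.card = p.natDegree := hsplit.natDegree_eq_card_roots.symm
  have hne : p.roots.toFinset.Nonempty := by
    rw [Multiset.toFinset_nonempty]
    exact fun h => hd (by simpa [h] using hcard.symm)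
  obtain ⟨w, hw, hmin⟩ := p.roots.toFinset.exists_min_image (fun w => ‖z - w‖) hne
  refine ⟨w, Polynomial.isRoot_of_mem_roots (Multiset.mem_toFinset.1 hw), ?_⟩
  have hprod : ‖p.eval z‖ = (p.roots.map fun w => ‖z - w‖).prod := by
    rw [hsplit.eval_eq_prod_roots_of_monic hp]
    change (normHom : ℂ →*₀ ℝ) _ = _
    rw [map_multiset_prod, Multiset.map_map]
    rfl
  rw [hprod, ← hcard]
  have := Multiset.prod_map_le_prod_map₀ (s := p.roots) (fun _ => ‖z - w‖) (fun w => ‖z - w‖)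
    (fun _ _ => norm_nonneg _) fun v hv => hmin v (Multiset.mem_toFinset.2 hv)
  simpa using this

/-- The non-vanishing locus of a nonzero complex polynomial is dense. -/
theorem MvPolynomial.dense_eval_ne_zero {d : ℕ} {g : MvPolynomial (Fin d) ℂ} (hg : g ≠ 0) :
    Dense {y | MvPolynomial.eval y g ≠ 0} := by
  intro b
  rw [Metric.mem_closure_iff]
  intro ε hε
  by_contra! H
  refine hg (MvPolynomial.funext_set (fun i => Metric.ball (b i) ε) (fun i => ?_) fun x hx => ?_)
  · exact infinite_of_mem_nhds (b i) (Metric.ball_mem_nhds _ hε)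
  · by_contra hne
    rw [map_zero] at hne
    refine (H x hne).not_gt ?_
    rw [dist_comm, dist_pi_lt_iff hε]
    exact fun i => hx i trivial

/-- The Cauchy bound of a monic polynomial depends continuously on its parameters. -/
theorem continuous_cauchyBound_map_eval {d : ℕ} {p : Polynomial (MvPolynomial (Fin d) ℂ)}
    (hp : p.Monic) :
    Continuous fun y : Fin d → ℂ => (p.map (MvPolynomial.eval y)).cauchyBound := by
  have h : (fun y : Fin d → ℂ => (p.map (MvPolynomial.eval y)).cauchyBound) = fun y =>
      (Finset.range p.natDegree).sup (fun i => ‖MvPolynomial.eval y (p.coeff i)‖₊) + 1 := by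
    ext y
    simp [Polynomial.cauchyBound, hp.natDegree_map, (hp.map (MvPolynomial.eval y)).leadingCoeff]
  rw [h]
  refine Continuous.add (Continuous.finset_sup_apply fun i _ => ?_) continuous_const
  exact (MvPolynomial.continuous_eval _).nnnorm

/-- The value of a polynomial over `ℂ[y₁,…,y_d]` depends continuously on the coefficients. -/
theorem continuous_eval_map_eval {d : ℕ} (p : Polynomial (MvPolynomial (Fin d) ℂ)) (z : ℂ) :
    Continuous fun y : Fin d → ℂ => (p.map (MvPolynomial.eval y)).eval z := by
  simp only [Polynomial.eval_map, Polynomial.eval₂_eq_sum_range]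
  exact continuous_finsetSum _ fun i _ => (MvPolynomial.continuous_eval _).mul continuous_const

/-- A ring homomorphism out of `A` extending the evaluation at `y` of its Noether normalization
`ℂ[y₁,…,y_d]` is evaluation at a point of the variety of `A`. -/
theorem map_eq_eval_of_comp_algebraMap {k d : ℕ} {A : Type*} [CommRing A] [Algebra ℂ A]
    [Algebra (MvPolynomial (Fin d) ℂ) A] [IsScalarTower ℂ (MvPolynomial (Fin d) ℂ) A]
    (ρ : MvPolynomial (Fin k) ℂ →ₐ[ℂ] A) (φ : A →+* ℂ) {y : Fin d → ℂ}
    (hφ : φ.comp (algebraMap _ A) = MvPolynomial.eval y)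
    (h : MvPolynomial (Fin k) ℂ) :
    φ (ρ h) = MvPolynomial.eval (fun i => φ (ρ (MvPolynomial.X i))) h := by
  have : φ.comp (ρ : MvPolynomial (Fin k) ℂ →+* A) =
      MvPolynomial.eval (fun i => φ (ρ (MvPolynomial.X i))) := by
    refine MvPolynomial.ringHom_ext (fun c => ?_) fun i => by simp
    have h1 : ρ (MvPolynomial.C c) = algebraMap (MvPolynomial (Fin d) ℂ) A (MvPolynomial.C c) := by
      rw [← MvPolynomial.algebraMap_eq, ρ.commutes, ← MvPolynomial.algebraMap_eq,
        ← IsScalarTower.algebraMap_apply]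
    have h2 := RingHom.congr_fun hφ (MvPolynomial.C c)
    simp only [RingHom.comp_apply, RingHom.coe_coe, MvPolynomial.eval_C] at h2 ⊢
    rw [h1, h2]
  exact RingHom.congr_fun this h

/-- For a finite projection of an irreducible affine variety onto affine space, the
non-vanishing locus of a nonzero regular function is Euclidean dense. -/
theorem mem_closure_eval_ne_zero_of_noether {k : ℕ} (d : ℕ) {A : Type*} [CommRing A] [IsDomain A]
    [Algebra ℂ A] [Algebra (MvPolynomial (Fin d) ℂ) A]
    [IsScalarTower ℂ (MvPolynomial (Fin d) ℂ) A]
    [Algebra.IsIntegral (MvPolynomial (Fin d) ℂ) A] [FaithfulSMul (MvPolynomial (Fin d) ℂ) A]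
    (ρ : MvPolynomial (Fin k) ℂ →ₐ[ℂ] A)
    (hρ : Function.Surjective ρ) {f : MvPolynomial (Fin k) ℂ} (hf : ρ f ≠ 0) {p : Fin k → ℂ}
    (hp : ∀ h, ρ h = 0 → MvPolynomial.eval p h = 0) :
    p ∈ closure {q | (∀ h, ρ h = 0 → MvPolynomial.eval q h = 0) ∧
      MvPolynomial.eval q f ≠ 0} := by
  let B := MvPolynomial (Fin d) ℂ
  have hint (a : A) : IsIntegral B a := Algebra.IsIntegral.isIntegral a
  obtain ⟨g, hg, a, ha⟩ := (hint (ρ f)).isAlgebraic.exists_nonzero_dvd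
    (mem_nonZeroDivisors_of_ne_zero hf)
  choose Y hY using fun j => hρ (algebraMap B A (MvPolynomial.X j))
  set b : Fin d → ℂ := fun j => MvPolynomial.eval p (Y j) with hb
  -- the fibre condition on a coordinate
  let c : Fin k → Polynomial B := fun i => minpoly B (ρ (MvPolynomial.X i))
  have hc (i) : (c i).Monic := minpoly.monic (hint _)
  have fibre (q : Fin k → ℂ) (hq : ∀ h, ρ h = 0 → MvPolynomial.eval q h = 0) (y : Fin d → ℂ)
      (hy : ∀ j, MvPolynomial.eval q (Y j) = y j) (h : MvPolynomial (Fin k) ℂ) :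
      (((minpoly B (ρ h)).map (MvPolynomial.eval y)).IsRoot (MvPolynomial.eval q h)) := by
    let φ : A →+* ℂ := (ρ : MvPolynomial (Fin k) ℂ →+* A).liftOfSurjective hρ
      ⟨MvPolynomial.eval q, fun h hh => hq h hh⟩
    have hφ (h) : φ (ρ h) = MvPolynomial.eval q h :=
      RingHom.liftOfSurjective_comp_apply _ hρ _ h
    have hφ' : φ.comp (algebraMap B A) = MvPolynomial.eval y := by
      refine MvPolynomial.ringHom_ext (fun c => ?_) fun j => ?_
      · have h1 : algebraMap B A (MvPolynomial.C c) = ρ (MvPolynomial.C c) := by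
          rw [← MvPolynomial.algebraMap_eq, ← MvPolynomial.algebraMap_eq, ρ.commutes,
            ← IsScalarTower.algebraMap_apply]
        rw [RingHom.comp_apply, h1, hφ]
        simp
      · rw [RingHom.comp_apply, ← hY, hφ, hy, MvPolynomial.eval_X]
    have h0 := congrArg φ (minpoly.aeval B (ρ h))
    rw [Polynomial.aeval_def, Polynomial.hom_eval₂, hφ', hφ, map_zero] at h0
    rwa [Polynomial.IsRoot.def, Polynomial.eval_map]
  -- a function separating `p` from the rest of its fibre
  let ℓ : MvPolynomial (Fin k) ℂ :=
    ∏ i, ∏ r ∈ ((c i).map (MvPolynomial.eval b)).roots.toFinset.erase (p i),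
      (MvPolynomial.X i - MvPolynomial.C r)
  have hℓp : MvPolynomial.eval p ℓ ≠ 0 := by
    simp only [ℓ, map_prod, map_sub, MvPolynomial.eval_X, MvPolynomial.eval_C,
      Finset.prod_ne_zero_iff]
    exact fun i _ r hr => sub_ne_zero.2 (Finset.ne_of_mem_erase hr).symm
  have hℓ (q : Fin k → ℂ) (hq : ∀ h, ρ h = 0 → MvPolynomial.eval q h = 0)
      (hqb : ∀ j, MvPolynomial.eval q (Y j) = b j) (hqp : q ≠ p) : MvPolynomial.eval q ℓ = 0 := by
    obtain ⟨i, hi⟩ := Function.ne_iff.1 hqp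
    have hroot := fibre q hq b hqb (MvPolynomial.X i)
    rw [MvPolynomial.eval_X] at hroot
    have hne : (c i).map (MvPolynomial.eval b) ≠ 0 := ((hc i).map _).ne_zero
    simp only [ℓ, map_prod, map_sub, MvPolynomial.eval_X, MvPolynomial.eval_C]
    refine Finset.prod_eq_zero (Finset.mem_univ i) (Finset.prod_eq_zero (i := q i) ?_ (sub_self _))
    rw [Finset.mem_erase, Multiset.mem_toFinset, Polynomial.mem_roots hne]
    exact ⟨hi, hroot⟩
  -- lift a sequence in the base
  obtain ⟨y, hy, hyb⟩ := mem_closure_iff_seq_limit.1 (MvPolynomial.dense_eval_ne_zero hg b)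
  let μ := minpoly B (ρ ℓ)
  have hμ : μ.Monic := minpoly.monic (hint _)
  have hμd : μ.natDegree ≠ 0 := (minpoly.natDegree_pos (hint _)).ne'
  have hroots (n : ℕ) := (hμ.map (MvPolynomial.eval (y n))).exists_isRoot_norm_sub_pow_le
    (by rwa [hμ.natDegree_map]) (MvPolynomial.eval p ℓ)
  choose z hz hzle using hroots
  simp only [hμ.natDegree_map] at hzle
  have hzlim : Tendsto z atTop (𝓝 (MvPolynomial.eval p ℓ)) := by
    have h0 : Tendsto (fun n => ‖(μ.map (MvPolynomial.eval (y n))).eval (MvPolynomial.eval p ℓ)‖)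
        atTop (𝓝 0) := by
      have := ((continuous_eval_map_eval μ (MvPolynomial.eval p ℓ)).tendsto b).comp hyb
      rw [(fibre p hp b (fun _ => rfl) ℓ).eq_zero] at this
      simpa using this.norm
    have h1 : Tendsto (fun n => ‖MvPolynomial.eval p ℓ - z n‖ ^ μ.natDegree) atTop (𝓝 0) :=
      squeeze_zero (fun _ => by positivity) hzle h0
    rw [tendsto_iff_norm_sub_tendsto_zero]
    have h2 := h1.rpow_const (p := (μ.natDegree : ℝ)⁻¹) (Or.inr (by positivity))
    rw [Real.zero_rpow (by simpa using hμd)] at h2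
    refine h2.congr fun n => ?_
    rw [Real.pow_rpow_inv_natCast (norm_nonneg _) hμd, norm_sub_rev]
  choose φ hφ hφz using fun n => exists_ringHom_extend_apply_eq (MvPolynomial.eval (y n)) (ρ ℓ)
    (z n) (by rw [← Polynomial.eval_map]; exact hz n)
  let q : ℕ → Fin k → ℂ := fun n i => φ n (ρ (MvPolynomial.X i))
  have hφq (n h) : φ n (ρ h) = MvPolynomial.eval (q n) h :=
    map_eq_eval_of_comp_algebraMap ρ (φ n) (hφ n) h
  have hq (n h) (hh : ρ h = 0) : MvPolynomial.eval (q n) h = 0 := by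
    rw [← hφq, hh, map_zero]
  have hqY (n j) : MvPolynomial.eval (q n) (Y j) = y n j := by
    rw [← hφq, hY, ← RingHom.comp_apply, hφ, MvPolynomial.eval_X]
  have hqf (n) : MvPolynomial.eval (q n) f ≠ 0 := by
    intro h0
    have h1 := congrArg (φ n) ha
    rw [← RingHom.comp_apply, hφ, map_mul, hφq, h0, zero_mul] at h1
    exact hy n h1
  -- the lifted sequence is bounded
  have hbdd : ∃ R, ∀ n, q n ∈ Metric.closedBall (0 : Fin k → ℂ) R := by
    have h1 (i : Fin k) : ∃ R : ℝ, ∀ n, ‖q n i‖ ≤ R := by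
      have hlim := ((NNReal.continuous_coe.comp (continuous_cauchyBound_map_eval (hc i))).tendsto
        b).comp hyb
      obtain ⟨R, hR⟩ := hlim.bddAbove_range
      refine ⟨R, fun n => le_trans ?_ (hR ⟨n, rfl⟩)⟩
      have hroot := fibre (q n) (hq n) (y n) (hqY n) (MvPolynomial.X i)
      rw [MvPolynomial.eval_X] at hroot
      exact_mod_cast (hroot.norm_lt_cauchyBound ((hc i).map _).ne_zero).le
    choose R hR using h1
    refine ⟨∑ i, |R i|, fun n => ?_⟩
    rw [mem_closedBall_zero_iff, pi_norm_le_iff_of_nonneg (by positivity)]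
    exact fun i => (hR i n).trans ((le_abs_self _).trans
      (Finset.single_le_sum (f := fun i => |R i|) (fun _ _ => abs_nonneg _) (Finset.mem_univ i)))
  obtain ⟨R, hR⟩ := hbdd
  obtain ⟨q', -, s, hs, hlim⟩ := tendsto_subseq_of_bounded Metric.isBounded_closedBall hR
  have hev (h : MvPolynomial (Fin k) ℂ) : Tendsto (fun n => MvPolynomial.eval (q (s n)) h) atTop
      (𝓝 (MvPolynomial.eval q' h)) := ((MvPolynomial.continuous_eval h).tendsto q').comp hlim
  have hq'p : q' = p := by
    by_contra hne
    have h1 : MvPolynomial.eval q' ℓ = 0 := by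
      refine hℓ q' (fun h hh => ?_) (fun j => ?_) hne
      · refine tendsto_nhds_unique (hev h) ?_
        simp [hq _ h hh]
      · refine tendsto_nhds_unique (hev (Y j)) ?_
        simp only [hqY]
        exact ((continuous_apply j).tendsto b).comp (hyb.comp hs.tendsto_atTop)
    refine hℓp (h1 ▸ tendsto_nhds_unique ?_ (hev ℓ))
    simp only [← hφq, hφz]
    exact hzlim.comp hs.tendsto_atTop
  rw [← hq'p]
  exact mem_closure_of_tendsto hlim (Eventually.of_forall fun n => ⟨hq _, hqf _⟩)

/-- A nonempty Zariski open subset of an irreducible complex affine variety is Euclidean dense. -/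
theorem mem_closure_zeros_eval_ne_zero {k : ℕ} (P : Ideal (MvPolynomial (Fin k) ℂ)) [P.IsPrime]
    {f : MvPolynomial (Fin k) ℂ} (hf : f ∉ P) {p : Fin k → ℂ}
    (hp : ∀ h ∈ P, MvPolynomial.eval p h = 0) :
    p ∈ closure {q | (∀ h ∈ P, MvPolynomial.eval q h = 0) ∧ MvPolynomial.eval q f ≠ 0} := by
  obtain ⟨d, g, hinj, hint⟩ :=
    exists_integral_inj_algHom_of_fg ℂ (MvPolynomial (Fin k) ℂ ⧸ P)
  algebraize [g.toRingHom]
  have : IsScalarTower ℂ (MvPolynomial (Fin d) ℂ) (MvPolynomial (Fin k) ℂ ⧸ P) :=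
    IsScalarTower.of_algebraMap_eq fun c => (g.commutes c).symm
  have : FaithfulSMul (MvPolynomial (Fin d) ℂ) (MvPolynomial (Fin k) ℂ ⧸ P) :=
    (faithfulSMul_iff_algebraMap_injective _ _).2 hinj
  have key := mem_closure_eval_ne_zero_of_noether d (p := p) (f := f)
    (Ideal.Quotient.mkₐ ℂ P) (Ideal.Quotient.mkₐ_surjective ℂ P)
    (by simpa [Ideal.Quotient.eq_zero_iff_mem] using hf)
    (by simpa [Ideal.Quotient.eq_zero_iff_mem] using hp)
  simpa [Ideal.Quotient.eq_zero_iff_mem] using key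

/-- Zariski closed sets are closed in the Euclidean topology. -/
theorem IsZariskiClosed.isClosed {k : ℕ} {Z : Set (Fin k → ℂ)} (hZ : IsZariskiClosed k Z) :
    IsClosed Z := by
  obtain ⟨T, rfl⟩ := hZ
  simp only [Set.ofPred_forall]
  exact isClosed_biInter fun p _ => isClosed_eq (MvPolynomial.continuous_eval p) continuous_const

/-- The Euclidean closure of the intersection of a Zariski closed set with a principal Zariski open
set is the zero locus of its vanishing ideal. -/
theorem closure_inter_eval_ne_zero_eq {k : ℕ} {Z : Set (Fin k → ℂ)} (hZ : IsZariskiClosed k Z)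
    (f : MvPolynomial (Fin k) ℂ) :
    closure (Z ∩ {x | MvPolynomial.eval x f ≠ 0}) =
      {x | ∀ p ∈ MvPolynomial.vanishingIdeal ℂ (Z ∩ {x | MvPolynomial.eval x f ≠ 0}),
        MvPolynomial.eval x p = 0} := by
  set V := Z ∩ {x | MvPolynomial.eval x f ≠ 0} with hV
  set J := MvPolynomial.vanishingIdeal ℂ V with hJ
  have memJ (p : MvPolynomial (Fin k) ℂ) : p ∈ J ↔ ∀ x ∈ V, MvPolynomial.eval x p = 0 := by
    rw [hJ, MvPolynomial.mem_vanishingIdeal_iff]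
    simp [MvPolynomial.aeval_eq_eval]
  obtain ⟨T, hT⟩ := hZ
  refine Set.Subset.antisymm ?_ fun x hx => ?_
  · exact closure_minimal (fun x hx p hp => (memJ p).1 hp x hx)
      (IsZariskiClosed.isClosed ⟨_, rfl⟩)
  · have hle : J ≤ RingHom.ker (MvPolynomial.eval x) := hx
    have : (RingHom.ker (MvPolynomial.eval x)).IsPrime := RingHom.ker_isPrime _
    obtain ⟨P, hP, hPx⟩ := Ideal.exists_minimalPrimes_le hle
    have := hP.isPrime
    have hf : f ∉ P := fun hfP => by
      obtain ⟨h, hh, hfh⟩ := Ideal.exists_mul_mem_of_mem_minimalPrimes hP hfP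
      refine hh ((memJ h).2 fun v hv => ?_)
      have := (memJ _).1 hfh v hv
      rw [map_mul] at this
      exact (mul_eq_zero.1 this).resolve_left hv.2
    refine closure_mono ?_ (mem_closure_zeros_eval_ne_zero P hf fun h hh => hPx hh)
    rintro q ⟨hq, hqf⟩
    refine ⟨?_, hqf⟩
    rw [hT]
    intro p hp
    refine hq p (hP.le ((memJ p).2 fun v hv => ?_))
    have := hv.1
    rw [hT] at this
    exact this p hp

/-- A matrix over a field has a nontrivial kernel iff all its maximal minors, one for each choice
of as many rows as there are columns, vanish. -/
theorem Matrix.exists_mulVec_eq_zero_iff_forall_det_submatrix {m n K : Type*} [Fintype m]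
    [Fintype n] [DecidableEq m] [DecidableEq n] [Field K] (M : Matrix m n K) :
    (∃ v ≠ 0, M.mulVec v = 0) ↔ ∀ s : n → m, (M.submatrix s id).det = 0 := by
  constructor
  · rintro ⟨v, hv, hMv⟩ s
    refine Matrix.exists_mulVec_eq_zero_iff.1 ⟨v, hv, ?_⟩
    ext i
    exact congrFun hMv (s i)
  · intro h
    by_contra! H
    have hinj : LinearMap.ker M.mulVecLin = ⊥ :=
      LinearMap.ker_eq_bot'.2 fun v hv => by_contra fun hne => H v hne hv
    obtain ⟨g, hg⟩ := M.mulVecLin.exists_leftInverse_of_injective hinj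
    set N := LinearMap.toMatrix' g with hN
    have hNM : N * M = 1 := by
      have := congrArg LinearMap.toMatrix' hg
      rwa [LinearMap.toMatrix'_comp, LinearMap.toMatrix'_id, ← Matrix.toLin'_apply',
        LinearMap.toMatrix'_toLin'] at this
    have hrow : N * M = fun i => ∑ a, N i a • M a := by
      ext i j
      simp [Matrix.mul_apply, Finset.sum_apply]
    have hdet : (N * M).det = 0 := by
      rw [hrow]
      change (Matrix.detRowAlternating (R := K) (n := n)).toMultilinearMap _ = 0
      rw [MultilinearMap.map_sum]
      refine Finset.sum_eq_zero fun s _ => ?_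
      rw [MultilinearMap.map_smul_univ]
      exact smul_eq_zero_of_right _ (h s)
    simp [hNM] at hdet

/-- The coefficients, as polynomials in `α`, expressing the `n`-th term of a solution of the
recurrence with coefficients `α` through its first `k` terms. -/
noncomputable def recCoeff (k : ℕ) (n : ℕ) : Fin k → MvPolynomial (Fin k) ℂ :=
  if h : n < k then Pi.single ⟨n, h⟩ 1
  else -∑ j : Fin k, MvPolynomial.X (R := ℂ) j • recCoeff k (n - ((j : ℕ) + 1))
termination_by n
decreasing_by have := j.2; omega

theorem recCoeff_of_lt {k n : ℕ} (h : n < k) : recCoeff k n = Pi.single ⟨n, h⟩ 1 := by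
  rw [recCoeff, dif_pos h]

theorem recCoeff_of_le {k n : ℕ} (h : k ≤ n) : recCoeff k n =
    -∑ j : Fin k, MvPolynomial.X (R := ℂ) j • recCoeff k (n - ((j : ℕ) + 1)) := by
  rw [recCoeff, dif_neg h.not_gt]

/-- Solutions of the recurrence are linear combinations of their first `k` terms, with the
coefficients `recCoeff`. -/
theorem eq_sum_recCoeff {k : ℕ} (α : Fin k → ℂ) {u : ℕ → ℂ}
    (hu : ∀ n, k ≤ n → u n + ∑ j : Fin k, α j * u (n - ((j : ℕ) + 1)) = 0) (n : ℕ) :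
    u n = ∑ i : Fin k, MvPolynomial.eval α (recCoeff k n i) * u i := by
  induction n using Nat.strong_induction_on with
  | _ n ih =>
    rcases lt_or_ge n k with h | h
    · rw [recCoeff_of_lt h, Finset.sum_eq_single ⟨n, h⟩] <;> simp +contextual
    · rw [eq_neg_of_add_eq_zero_left (hu n h), recCoeff_of_le h]
      have : ∀ j : Fin k, n - ((j : ℕ) + 1) < n := fun j => by omega
      simp only [fun j => ih _ (this j), Finset.mul_sum, Pi.neg_apply, Finset.sum_apply,
        Pi.smul_apply, smul_eq_mul, map_neg, map_sum, map_mul, MvPolynomial.eval_X, neg_mul,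
        Finset.sum_neg_distrib, Finset.sum_mul]
      rw [Finset.sum_comm]
      simp only [mul_assoc]

/-- The sequence built from initial values with the coefficients `recCoeff` solves the
recurrence. -/
theorem sum_recCoeff_add_eq_zero {k : ℕ} (α v : Fin k → ℂ) {n : ℕ} (h : k ≤ n) :
    ∑ i : Fin k, MvPolynomial.eval α (recCoeff k n i) * v i +
      ∑ j : Fin k, α j * ∑ i : Fin k,
        MvPolynomial.eval α (recCoeff k (n - ((j : ℕ) + 1)) i) * v i = 0 := by
  rw [recCoeff_of_le h]
  simp only [Finset.mul_sum, Pi.neg_apply, Finset.sum_apply, Pi.smul_apply, smul_eq_mul, map_neg,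
    map_sum, map_mul, MvPolynomial.eval_X, neg_mul, Finset.sum_neg_distrib, Finset.sum_mul]
  rw [Finset.sum_comm]
  simp only [mul_assoc, neg_add_cancel]

/-- The linear recurrence variety is the intersection of a Zariski closed set with the
non-vanishing locus of the last coordinate. -/
theorem recVariety_eq_inter (k : ℕ) (hk : 1 ≤ k) (I : Finset ℕ) :
    ∃ Z, IsZariskiClosed k Z ∧ recVariety k hk I =
      Z ∩ {x | MvPolynomial.eval x (MvPolynomial.X ⟨k - 1, by omega⟩) ≠ 0} := by
  let M : Matrix I (Fin k) (MvPolynomial (Fin k) ℂ) := fun n => recCoeff k n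
  refine ⟨_, ⟨Set.range fun s : Fin k → I => (M.submatrix s id).det, rfl⟩, ?_⟩
  ext α
  have hdet (s : Fin k → I) : MvPolynomial.eval α (M.submatrix s id).det =
      ((M.map (MvPolynomial.eval α)).submatrix s id).det := by
    rw [RingHom.map_det]
    rfl
  simp only [recVariety, Set.mem_ofPred_eq, Set.mem_inter_iff, MvPolynomial.eval_X,
    Set.forall_mem_range, hdet, ← Matrix.exists_mulVec_eq_zero_iff_forall_det_submatrix]
  rw [and_comm]
  refine and_congr_left fun _ => ⟨?_, ?_⟩
  · rintro ⟨u, hu0, hu, hI⟩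
    refine ⟨fun i => u i, fun h0 => hu0 ?_, ?_⟩
    · ext n
      rw [eq_sum_recCoeff α hu n]
      exact Finset.sum_eq_zero fun i _ => by rw [show u i = 0 from congrFun h0 i, mul_zero]
    · ext n
      rw [Pi.zero_apply, ← hI n n.2, eq_sum_recCoeff α hu n]
      rfl
  · rintro ⟨v, hv0, hv⟩
    refine ⟨fun n => ∑ i : Fin k, MvPolynomial.eval α (recCoeff k n i) * v i, fun h0 => hv0 ?_,
      fun n hn => sum_recCoeff_add_eq_zero α v hn, fun n hn => congrFun hv ⟨n, hn⟩⟩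
    ext j
    have := congrFun h0 j
    simp only [recCoeff_of_lt j.2] at this
    rw [Finset.sum_eq_single j (by simp +contextual) (by simp)] at this
    simpa using this

/-- Proposition `pr:alg`: the linear recurrence variety `V_{k;I}` is a constructible
subset of `ℂ^k` in the Zariski topology (a finite union of sets `U ∩ Z` with `U` Zariski
open and `Z` Zariski closed); consequently its closure in the Euclidean topology of
`ℂ^k` coincides with its Zariski closure and is an affine algebraic set. -/
theorem recVariety_constructible (k : ℕ) (hk : 2 ≤ k) (I : Finset ℕ) :
    (∃ (n : ℕ) (C D : Fin n → Set (Fin k → ℂ)),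
        (∀ a, IsZariskiClosed k (C a)) ∧ (∀ a, IsZariskiClosed k (D a)) ∧
        recVariety k (by omega) I = ⋃ a, ((D a)ᶜ ∩ C a)) ∧
      closure (recVariety k (by omega : 1 ≤ k) I) =
        ⋂₀ {Z | IsZariskiClosed k Z ∧ recVariety k (by omega : 1 ≤ k) I ⊆ Z} ∧
      IsZariskiClosed k (closure (recVariety k (by omega : 1 ≤ k) I)) := by
  obtain ⟨Z, hZ, hV⟩ := recVariety_eq_inter k (by omega) I
  have hcl := closure_inter_eval_ne_zero_eq hZ (MvPolynomial.X ⟨k - 1, by omega⟩)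
  rw [← hV] at hcl
  have hclosed : IsZariskiClosed k (closure (recVariety k (by omega : 1 ≤ k) I)) := ⟨_, hcl⟩
  refine ⟨⟨1, fun _ => Z, fun _ => {x | MvPolynomial.eval x
    (MvPolynomial.X ⟨k - 1, by omega⟩) = 0}, fun _ => hZ,
    fun _ => ⟨{MvPolynomial.X ⟨k - 1, by omega⟩}, by simp⟩, ?_⟩, ?_, hclosed⟩
  · rw [hV, Set.iUnion_const, Set.inter_comm]
    rfl
  · refine Set.Subset.antisymm (Set.subset_sInter ?_)
      (Set.sInter_subset_of_mem ⟨hclosed, subset_closure⟩)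
    exact fun W hW => closure_minimal hW.2 hW.1.isClosed
end
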